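/- Let e ∈ [0,1) and j ∈ ℤ. Then α_j(e) = −(1/4π)·∫₀^{2π} [ (w(u)⁴ − 6·w(u)² + 1)·cos(j·u − j·e·sin u) − 4·w(u)·(w(u)² − 1)·sin(j·u − j·e·sin u) ] / ( (1 − e·cos u)² · (w(u)² + 1)² ) du, where w(u) := √((1+e)/(1−e))·tan(u/2), and the integrand (which is defined for u ∈ (0,2π)∖{π}) is integrated in the Lebesgue sense over [0,2π]. -/

import Mathlib

open Real

/-- The derivative of `v ↦ v - e * sin v` is positive for `0 ≤ e < 1`. -/
lemma one_sub_mul_cos_pos {e : ℝ} (he : e ∈ Set.Ico (0 : ℝ) 1) (v : ℝ) :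
    0 < 1 - e * Real.cos v := by
  obtain ⟨h0, h1⟩ := he
  nlinarith [Real.cos_le_one v, mul_le_mul_of_nonneg_left (Real.cos_le_one v) h0]

lemma hasDerivAt_kepler (e v : ℝ) :
    HasDerivAt (fun v => v - e * Real.sin v) (1 - e * Real.cos v) v :=
  (hasDerivAt_id v).sub ((Real.hasDerivAt_sin v).const_mul e)

lemma kepler_strictMono {e : ℝ} (he : e ∈ Set.Ico (0 : ℝ) 1) :
    StrictMono (fun v : ℝ => v - e * Real.sin v) := by
  apply strictMono_of_deriv_pos
  intro v
  rw [(hasDerivAt_kepler e v).deriv]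
  exact one_sub_mul_cos_pos he v

/-- Change of variables from the mean anomaly to the eccentric anomaly over one period. -/
lemma integral_kepler {e : ℝ} (he : e ∈ Set.Ico (0 : ℝ) 1) (g : ℝ → ℂ) :
    ∫ t in (0 : ℝ)..(2 * π), g t =
      ∫ v in (0 : ℝ)..(2 * π), ((1 - e * Real.cos v : ℝ) : ℂ) * g (v - e * Real.sin v) := by
  have hpi : (0 : ℝ) ≤ 2 * π := by positivity
  have himage : (fun v : ℝ => v - e * Real.sin v) '' Set.Icc 0 (2 * π) = Set.Icc 0 (2 * π) := by
    have hcont : ContinuousOn (fun v : ℝ => v - e * Real.sin v) (Set.Icc 0 (2 * π)) := by fun_prop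
    have h := hcont.image_Icc_of_monotoneOn hpi ((kepler_strictMono he).monotone.monotoneOn _)
    simpa using h
  have h := MeasureTheory.integral_image_eq_integral_abs_deriv_smul
    (measurableSet_Icc (a := (0 : ℝ)) (b := 2 * π))
    (fun v _ => (hasDerivAt_kepler e v).hasDerivWithinAt)
    ((kepler_strictMono he).injective.injOn) g
  rw [himage] at h
  rw [intervalIntegral.integral_of_le hpi, intervalIntegral.integral_of_le hpi,
    ← MeasureTheory.integral_Icc_eq_integral_Ioc, ← MeasureTheory.integral_Icc_eq_integral_Ioc, h]
  refine MeasureTheory.integral_congr_ae (Filter.Eventually.of_forall fun v => ?_)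
  simp only [abs_of_pos (one_sub_mul_cos_pos he v), Complex.real_smul]

/-- A function that is odd about the midpoint of `[0, a]` integrates to zero. -/
lemma integral_eq_zero_of_reflect_neg {B : ℝ → ℝ} {a : ℝ} (h : ∀ v, B (a - v) = -B v) :
    ∫ v in (0 : ℝ)..a, B v = 0 := by
  have h1 := intervalIntegral.integral_comp_sub_left (a := 0) (b := a) B a
  simp only [h, intervalIntegral.integral_neg, sub_self, sub_zero] at h1
  linarith

lemma cos_half_ne_zero {v : ℝ} (hv : v ∈ Set.Ioc 0 (2 * π)) (hne : v ≠ π) :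
    Real.cos (v / 2) ≠ 0 := by
  obtain ⟨h0, h1⟩ := hv
  rcases lt_or_gt_of_ne hne with h | h
  · exact (Real.cos_pos_of_mem_Ioo ⟨by linarith, by linarith⟩).ne'
  · exact (Real.cos_neg_of_pi_div_two_lt_of_lt (by linarith) (by linarith)).ne

/-- The half-angle relation between the true and the eccentric anomaly: `w = tan (f / 2)`. -/
lemma half_angle_anomaly {e : ℝ} (he : e ∈ Set.Ico (0 : ℝ) 1) {v w : ℝ}
    (hv : Real.cos (v / 2) ≠ 0)
    (hw : w = Real.sqrt ((1 + e) / (1 - e)) * Real.tan (v / 2)) :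
    (Real.cos v - e) / (1 - e * Real.cos v) = (1 - w ^ 2) / (1 + w ^ 2) ∧
    Real.sqrt (1 - e ^ 2) * Real.sin v / (1 - e * Real.cos v) = 2 * w / (1 + w ^ 2) := by
  obtain ⟨h0, h1⟩ := he
  have h1e : 0 < 1 - e := by linarith
  have hk2 : Real.sqrt ((1 + e) / (1 - e)) ^ 2 * (1 - e) = 1 + e := by
    rw [Real.sq_sqrt (by positivity)]
    field_simp
  have hs : Real.sqrt (1 - e ^ 2) = (1 - e) * Real.sqrt ((1 + e) / (1 - e)) := by
    rw [show 1 - e ^ 2 = ((1 - e) * Real.sqrt ((1 + e) / (1 - e))) ^ 2 by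
      linear_combination (-(1 - e)) * hk2]
    exact Real.sqrt_sq (by positivity)
  have hT : w * Real.cos (v / 2) = Real.sqrt ((1 + e) / (1 - e)) * Real.sin (v / 2) := by
    rw [hw, Real.tan_eq_sin_div_cos]
    field_simp
  have hcos : Real.cos v = 2 * Real.cos (v / 2) ^ 2 - 1 := by
    rw [← Real.cos_two_mul]; ring_nf
  have hsin : Real.sin v = 2 * Real.sin (v / 2) * Real.cos (v / 2) := by
    rw [← Real.sin_two_mul]; ring_nf
  have hSC := Real.sin_sq_add_cos_sq (v / 2)
  rw [hs, hcos, hsin]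
  generalize Real.sqrt ((1 + e) / (1 - e)) = k at *
  generalize Real.cos (v / 2) = C at *
  generalize Real.sin (v / 2) = S at *
  have hW : (1 - e) * (w * C) ^ 2 = (1 + e) * S ^ 2 := by
    rw [hT]; linear_combination S ^ 2 * hk2
  have hden : 1 - e * (2 * C ^ 2 - 1) = (1 - e) * C ^ 2 * (1 + w ^ 2) := by
    linear_combination -hW - (1 + e) * hSC
  have hnum : 2 * C ^ 2 - 1 - e = (1 - e) * C ^ 2 * (1 - w ^ 2) := by
    linear_combination hW + (1 + e) * hSC
  have hw2 : (1 + w ^ 2) ≠ 0 := by positivity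
  rw [hden, hnum]
  constructor
  · field_simp
  · rw [show (1 - e) * k * (2 * S * C) = (1 - e) * C ^ 2 * (2 * w) by
      linear_combination (-2 * (1 - e) * C) * hT]
    field_simp

theorem stmt_17 (e : ℝ) (he : e ∈ Set.Ico (0 : ℝ) 1)
    (uE : ℝ → ℝ) (huE : ∀ t, t = uE t - e * Real.sin (uE t))
    (fE : ℝ → ℝ)
    (hfEc : ∀ t, Real.cos (fE t) = (Real.cos (uE t) - e) / (1 - e * Real.cos (uE t)))
    (hfEs : ∀ t, Real.sin (fE t) =
      Real.sqrt (1 - e ^ 2) * Real.sin (uE t) / (1 - e * Real.cos (uE t)))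
    (G : ℝ → ℂ)
    (hG : ∀ t, G t = -Complex.exp (2 * Complex.I * (fE t)) /
      (2 * ((1 - e * Real.cos (uE t) : ℝ) : ℂ) ^ 3))
    (j : ℤ) (αj : ℂ)
    (hαj : αj = (1 / (2 * π) : ℂ) *
      ∫ t in (0:ℝ)..(2 * π), G t * Complex.exp (-(j : ℂ) * Complex.I * t))
    (w : ℝ → ℝ) (hw : ∀ v, w v = Real.sqrt ((1 + e) / (1 - e)) * Real.tan (v / 2)) :
    αj = ((-(1 / (4 * π)) * ∫ v in (0:ℝ)..(2 * π),
      ((w v ^ 4 - 6 * w v ^ 2 + 1) * Real.cos ((j : ℝ) * v - (j : ℝ) * e * Real.sin v) -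
        4 * w v * (w v ^ 2 - 1) * Real.sin ((j : ℝ) * v - (j : ℝ) * e * Real.sin v)) /
      ((1 - e * Real.cos v) ^ 2 * (w v ^ 2 + 1) ^ 2) : ℝ) : ℂ) := by
  have hρ := one_sub_mul_cos_pos he
  have huv (v : ℝ) : uE (v - e * Real.sin v) = v :=
    (kepler_strictMono he).injective (huE (v - e * Real.sin v)).symm
  set c : ℝ → ℝ := fun v => (Real.cos v - e) / (1 - e * Real.cos v) with hc
  set s : ℝ → ℝ := fun v => Real.sqrt (1 - e ^ 2) * Real.sin v / (1 - e * Real.cos v) with hs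
  set θ : ℝ → ℝ := fun v => (j : ℝ) * v - (j : ℝ) * e * Real.sin v with hθ
  set A : ℝ → ℝ := fun v => ((c v ^ 2 - s v ^ 2) * Real.cos (θ v) +
    2 * c v * s v * Real.sin (θ v)) / (1 - e * Real.cos v) ^ 2 with hA
  set B : ℝ → ℝ := fun v => (2 * c v * s v * Real.cos (θ v) -
    (c v ^ 2 - s v ^ 2) * Real.sin (θ v)) / (1 - e * Real.cos v) ^ 2 with hB
  have hcc : Continuous c :=
    Continuous.div (by fun_prop) (by fun_prop) fun v => (hρ v).ne'
  have hsc : Continuous s :=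
    Continuous.div (by fun_prop) (by fun_prop) fun v => (hρ v).ne'
  have hAc : Continuous A :=
    Continuous.div (by fun_prop) (by fun_prop) fun v => pow_ne_zero 2 (hρ v).ne'
  have hBc : Continuous B :=
    Continuous.div (by fun_prop) (by fun_prop) fun v => pow_ne_zero 2 (hρ v).ne'
  have hpt (v : ℝ) : ((1 - e * Real.cos v : ℝ) : ℂ) * (G (v - e * Real.sin v) *
      Complex.exp (-(j : ℂ) * Complex.I * ((v - e * Real.sin v : ℝ) : ℂ))) =
      (-1 / 2 : ℂ) * ((A v : ℂ) + (B v : ℂ) * Complex.I) := by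
    have hf : Complex.exp (2 * Complex.I * (fE (v - e * Real.sin v))) =
        ((c v : ℂ) + (s v : ℂ) * Complex.I) ^ 2 := by
      have h1 := hfEc (v - e * Real.sin v)
      have h2 := hfEs (v - e * Real.sin v)
      rw [huv] at h1 h2
      rw [show 2 * Complex.I * (fE (v - e * Real.sin v) : ℂ) =
        (2 : ℕ) * ((fE (v - e * Real.sin v) : ℂ) * Complex.I) by push_cast; ring,
        Complex.exp_nat_mul, Complex.exp_mul_I, ← Complex.ofReal_cos, ← Complex.ofReal_sin, h1, h2]
    have hj : Complex.exp (-(j : ℂ) * Complex.I * ((v - e * Real.sin v : ℝ) : ℂ)) =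
        (Real.cos (θ v) : ℂ) - (Real.sin (θ v) : ℂ) * Complex.I := by
      rw [show -(j : ℂ) * Complex.I * ((v - e * Real.sin v : ℝ) : ℂ) =
        ((-(θ v) : ℝ) : ℂ) * Complex.I by simp only [hθ]; push_cast; ring,
        Complex.exp_mul_I, ← Complex.ofReal_cos, ← Complex.ofReal_sin, Real.cos_neg, Real.sin_neg]
      push_cast
      ring
    have hρ' : ((1 - e * Real.cos v : ℝ) : ℂ) ≠ 0 := Complex.ofReal_ne_zero.mpr (hρ v).ne'
    rw [hG, huv, hf, hj]
    simp only [hA, hB]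
    rw [Complex.ofReal_div _ ((1 - e * Real.cos v) ^ 2),
      Complex.ofReal_div _ ((1 - e * Real.cos v) ^ 2), Complex.ofReal_pow (1 - e * Real.cos v)]
    generalize ((1 - e * Real.cos v : ℝ) : ℂ) = r at *
    generalize Real.cos (θ v) = x
    generalize Real.sin (θ v) = y
    generalize c v = p
    generalize s v = q
    push_cast
    field_simp
    ring_nf
    simp only [Complex.I_sq, Complex.I_pow_three]
    ring
  have hB0 : ∫ v in (0 : ℝ)..(2 * π), B v = 0 := by
    apply integral_eq_zero_of_reflect_neg
    intro v
    have hθ' : θ (2 * π - v) = (j : ℝ) * (2 * π) - θ v := by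
      simp only [hθ, Real.sin_two_pi_sub]
      ring
    simp only [hB, hθ', Real.cos_int_mul_two_pi_sub, Real.sin_int_mul_two_pi_sub]
    simp only [hc, hs, Real.cos_two_pi_sub, Real.sin_two_pi_sub]
    ring
  have hAint : ∫ v in (0 : ℝ)..(2 * π), A v = ∫ v in (0 : ℝ)..(2 * π),
      ((w v ^ 4 - 6 * w v ^ 2 + 1) * Real.cos (θ v) -
        4 * w v * (w v ^ 2 - 1) * Real.sin (θ v)) /
      ((1 - e * Real.cos v) ^ 2 * (w v ^ 2 + 1) ^ 2) := by
    apply intervalIntegral.integral_congr_ae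
    have hne : ∀ᵐ v : ℝ, v ≠ π := by
      simp [MeasureTheory.ae_iff]
    filter_upwards [hne] with v hv hmem
    rw [Set.uIoc_of_le (by positivity)] at hmem
    obtain ⟨h1, h2⟩ := half_angle_anomaly he (cos_half_ne_zero hmem hv) (hw v)
    have hr := (hρ v).ne'
    have hw2 : 1 + w v ^ 2 ≠ 0 := by positivity
    simp only [hA]
    rw [show c v = _ from h1, show s v = _ from h2, add_comm (w v ^ 2) 1]
    generalize 1 - e * Real.cos v = r at *
    field_simp
    ring
  have hAi : IntervalIntegrable (fun v => (A v : ℂ)) MeasureTheory.volume 0 (2 * π) :=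
    (Complex.continuous_ofReal.comp hAc).intervalIntegrable _ _
  have hBi : IntervalIntegrable (fun v => (B v : ℂ) * Complex.I) MeasureTheory.volume 0 (2 * π) :=
    ((Complex.continuous_ofReal.comp hBc).mul continuous_const).intervalIntegrable _ _
  rw [hαj, integral_kepler he, ← hAint]
  simp only [hpt]
  rw [intervalIntegral.integral_const_mul, intervalIntegral.integral_add hAi hBi,
    intervalIntegral.integral_mul_const, intervalIntegral.integral_ofReal,
    intervalIntegral.integral_ofReal, hB0]
  push_cast
  ring
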